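/- (The contact sets avoid the degeneracy curves.) Let φ₋, φ₊ : ℝ^d → ℝ be non-constant C⁴, (2πℤ)^d-periodic functions with φ₊ − φ₋ ≥ τ everywhere for some τ > 0, assume max φ₋ ≥ min φ₊, and assume the non-degeneracy condition ∇(Δφ₋)(x) ≠ 0 for every x with Δφ₋(x) = 0 and ∇(Δφ₊)(x) ≠ 0 for every x with Δφ₊(x) = 0. Let u be the unique continuous periodic solution of the double obstacle problem. Then {u = φ₋} ∩ (Δφ₋)^{−1}(0) = ∅ and {u = φ₊} ∩ (Δφ₊)^{−1}(0) = ∅. -/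

import Mathlib

open MeasureTheory Real

noncomputable section

/-- Euclidean space `ℝ^d`. -/
abbrev Rd (d : ℕ) := EuclideanSpace ℝ (Fin d)

/-- `f : ℝ^d → α` is `(2πℤ)^d`-periodic. -/
def PeriodicRd {d : ℕ} {α : Type*} (f : Rd d → α) : Prop :=
  ∀ (x : Rd d) (j : Fin d),
    f (x + (2 * Real.pi) • EuclideanSpace.single j (1 : ℝ)) = f x

/-- The Euclidean Laplacian `Δ = ∑ ∂²/∂xⱼ²`. -/
noncomputable def lapRd {d : ℕ} (f : Rd d → ℝ) (x : Rd d) : ℝ :=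
  ∑ j : Fin d,
    fderiv ℝ (fun y => fderiv ℝ f y (EuclideanSpace.single j (1 : ℝ))) x
      (EuclideanSpace.single j (1 : ℝ))

/-- The fundamental domain `E = [0,2π)^d`. -/
def EfdR (d : ℕ) : Set (Rd d) := {x | ∀ j : Fin d, x j ∈ Set.Ico 0 (2 * Real.pi)}

/-- `u` is a solution of the double obstacle problem with obstacles `φ₋ ≤ u ≤ φ₊`:
`u` is continuous, periodic, trapped between the obstacles, distributionally
subharmonic on `{u > φ₋}` and distributionally superharmonic on `{u < φ₊}`. -/
def IsDOPSolution {d : ℕ} (φm φp u : Rd d → ℝ) : Prop :=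
  Continuous u ∧ PeriodicRd u ∧ (∀ x, φm x ≤ u x ∧ u x ≤ φp x) ∧
    (∀ χ : Rd d → ℝ, ContDiff ℝ (⊤ : ℕ∞) χ → HasCompactSupport χ → (∀ x, 0 ≤ χ x) →
      tsupport χ ⊆ {x | φm x < u x} → 0 ≤ ∫ x : Rd d, u x * lapRd χ x) ∧
    (∀ χ : Rd d → ℝ, ContDiff ℝ (⊤ : ℕ∞) χ → HasCompactSupport χ → (∀ x, 0 ≤ χ x) →
      tsupport χ ⊆ {x | u x < φp x} → (∫ x : Rd d, u x * lapRd χ x) ≤ 0)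

open scoped Convolution Topology

section Laplacian

variable {d : ℕ}

/-- The `j`-th vector of the standard basis. -/
local notation "𝐞" j => EuclideanSpace.single j (1 : ℝ)

lemma contDiff_fderiv_apply_const {n : ℕ} {f : Rd d → ℝ} (hf : ContDiff ℝ (n + 1) f) (v : Rd d) :
    ContDiff ℝ n (fun y => fderiv ℝ f y v) :=
  (hf.fderiv_right (m := n) le_rfl).clm_apply contDiff_const

lemma lapRd_sub {f g : Rd d → ℝ} (hf : ContDiff ℝ 2 f) (hg : ContDiff ℝ 2 g) (x : Rd d) :
    lapRd (fun y => f y - g y) x = lapRd f x - lapRd g x := by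
  have hf1 : Differentiable ℝ f := hf.differentiable (by norm_num)
  have hg1 : Differentiable ℝ g := hg.differentiable (by norm_num)
  have hf2 (v : Rd d) : Differentiable ℝ (fun y => fderiv ℝ f y v) :=
    (contDiff_fderiv_apply_const (n := 1) (by simpa [one_add_one_eq_two] using hf) v).differentiable
      (by norm_num)
  have hg2 (v : Rd d) : Differentiable ℝ (fun y => fderiv ℝ g y v) :=
    (contDiff_fderiv_apply_const (n := 1) (by simpa [one_add_one_eq_two] using hg) v).differentiable
      (by norm_num)
  unfold lapRd
  rw [← Finset.sum_sub_distrib]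
  refine Finset.sum_congr rfl fun j _ => ?_
  have h : (fun y => fderiv ℝ (fun y => f y - g y) y (𝐞 j)) =
      fun y => fderiv ℝ f y (𝐞 j) - fderiv ℝ g y (𝐞 j) := by
    funext y
    rw [fderiv_fun_sub (hf1 y) (hg1 y)]
    rfl
  rw [h, fderiv_fun_sub (hf2 _ x) (hg2 _ x)]
  rfl

lemma lapRd_neg (f : Rd d → ℝ) (x : Rd d) : lapRd (fun y => -f y) x = -lapRd f x := by
  simp [lapRd, fderiv_fun_neg, Finset.sum_neg_distrib]

lemma contDiff_lapRd {n : ℕ} {f : Rd d → ℝ} (hf : ContDiff ℝ (n + 2) f) :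
    ContDiff ℝ n (lapRd f) := by
  unfold lapRd
  refine ContDiff.sum fun j _ => contDiff_fderiv_apply_const
    (contDiff_fderiv_apply_const (n := n + 1) ?_ _) _
  convert hf using 1
  push_cast
  rw [add_assoc, one_add_one_eq_two]

/-- Second order necessary condition at a local minimum. -/
lemma IsLocalMin.lapRd_nonneg {f : Rd d → ℝ} (hf : ContDiff ℝ 2 f) {z : Rd d}
    (hz : IsLocalMin f z) : 0 ≤ lapRd f z := by
  refine Finset.sum_nonneg fun j _ => ?_
  by_contra! hneg
  set γ : ℝ → Rd d := fun t => z + t • 𝐞 j with hγ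
  have hγ0 : γ 0 = z := by simp [hγ]
  have hγd (t : ℝ) : HasDerivAt γ (𝐞 j) t := by
    have h := ((hasDerivAt_id t).smul_const (𝐞 j)).const_add z
    rwa [one_smul] at h
  have hf1 : Differentiable ℝ f := hf.differentiable (by norm_num)
  have hf2 : Differentiable ℝ (fun y => fderiv ℝ f y (𝐞 j)) :=
    (contDiff_fderiv_apply_const (n := 1) (by simpa [one_add_one_eq_two] using hf) _).differentiable
      (by norm_num)
  have hd1 : deriv (f ∘ γ) = fun t => fderiv ℝ f (γ t) (𝐞 j) := by
    funext t
    exact ((hf1 (γ t)).hasFDerivAt.comp_hasDerivAt t (hγd t)).deriv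
  have hd2 : deriv (deriv (f ∘ γ)) 0 =
      fderiv ℝ (fun y => fderiv ℝ f y (𝐞 j)) z (𝐞 j) := by
    rw [hd1, ← hγ0]
    exact ((hf2 (γ 0)).hasFDerivAt.comp_hasDerivAt (0 : ℝ) (hγd 0)).deriv
  have hcont : ContinuousAt γ 0 := (hγd 0).continuousAt
  have hmin : IsLocalMin (f ∘ γ) 0 := by
    have h := hcont.tendsto
    rw [hγ0] at h
    filter_upwards [h.eventually hz] with t ht
    simpa [hγ0] using ht
  have hmax : IsLocalMax (f ∘ γ) 0 := by
    refine isLocalMax_of_deriv_deriv_neg (hd2 ▸ hneg) hmin.deriv_eq_zero ?_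
    exact (hf1.continuous.continuousAt).comp hcont
  have hconst : f ∘ γ =ᶠ[𝓝 0] fun _ => (f ∘ γ) 0 := by
    filter_upwards [hmin, hmax] with t h1 h2
    exact le_antisymm h2 h1
  have : deriv (deriv (f ∘ γ)) 0 = 0 := by
    rw [hconst.deriv.deriv_eq]
    simp
  linarith [hd2 ▸ this]

/-- The Laplacian of a mollification falls on the mollifier. -/
lemma lapRd_convolution {u ρ : Rd d → ℝ} (hu : Continuous u) (hρ : ContDiff ℝ 2 ρ)
    (hρc : HasCompactSupport ρ) (x : Rd d) :
    lapRd (u ⋆[ContinuousLinearMap.lsmul ℝ ℝ] ρ) x = ∫ y, u y * lapRd ρ (x - y) := by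
  have hul : LocallyIntegrable u := hu.locallyIntegrable
  have key {g : Rd d → ℝ} (hg : ContDiff ℝ 1 g) (hgc : HasCompactSupport g) (y v : Rd d) :
      fderiv ℝ (u ⋆[ContinuousLinearMap.lsmul ℝ ℝ] g) y v =
        (u ⋆[ContinuousLinearMap.lsmul ℝ ℝ] fun a => fderiv ℝ g a v) y := by
    rw [(hgc.hasFDerivAt_convolution_right (ContinuousLinearMap.lsmul ℝ ℝ) hul hg y).fderiv]
    exact convolution_precompR_apply _ hul (hgc.fderiv ℝ) (hg.continuous_fderiv (by norm_num)) y v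
  have h1 (v : Rd d) : ContDiff ℝ 1 (fun y => fderiv ℝ ρ y v) :=
    contDiff_fderiv_apply_const (n := 1) (by simpa [one_add_one_eq_two] using hρ) v
  have hc1 (v : Rd d) : HasCompactSupport (fun y => fderiv ℝ ρ y v) := hρc.fderiv_apply ℝ v
  have hint (v : Rd d) :
      Integrable fun y => u y * fderiv ℝ (fun a => fderiv ℝ ρ a v) (x - y) v := by
    refine Continuous.integrable_of_hasCompactSupport ?_ ?_
    · exact hu.mul ((((h1 v).continuous_fderiv (by norm_num)).clm_apply
        continuous_const).comp (continuous_const.sub continuous_id))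
    · exact (((hc1 v).fderiv_apply ℝ v).comp_homeomorph (Homeomorph.subLeft x)).mul_left
  unfold lapRd
  simp_rw [Finset.mul_sum]
  rw [integral_finsetSum _ fun j _ => hint _]
  refine Finset.sum_congr rfl fun j _ => ?_
  have : (fun y => fderiv ℝ (u ⋆[ContinuousLinearMap.lsmul ℝ ℝ] ρ) y (𝐞 j)) =
      (u ⋆[ContinuousLinearMap.lsmul ℝ ℝ] fun a => fderiv ℝ ρ a (𝐞 j)) :=
    funext fun y => key (hρ.of_le (by norm_num)) hρc y _
  rw [this, key (h1 _) (hc1 _)]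
  rfl

lemma lapRd_comp_const_sub (ρ : Rd d → ℝ) (x y : Rd d) :
    lapRd (fun a => ρ (x - a)) y = lapRd ρ (x - y) := by
  have h (f : Rd d → ℝ) (b v : Rd d) :
      fderiv ℝ (fun a => f (x - a)) b v = -fderiv ℝ f (x - b) v := by
    have h := (ContinuousLinearEquiv.neg ℝ (M := Rd d)).comp_right_fderiv
      (f := fun a => f (x + a)) (x := b)
    rw [fderiv_comp_add_left] at h
    have h' := DFunLike.congr_fun h v
    simpa [Function.comp_def, ← sub_eq_add_neg] using h'
  unfold lapRd
  refine Finset.sum_congr rfl fun j _ => ?_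
  simp_rw [h]
  rw [fderiv_fun_neg, neg_apply,
    h (fun a => fderiv ℝ ρ a (𝐞 j)), neg_neg]

/-- Laplacian of the product of `R² - ‖x - c‖²` with an affine function. -/
lemma lapRd_barrier (c : Rd d) (R α β : ℝ) (l : Rd d →L[ℝ] ℝ) (x : Rd d) :
    lapRd (fun y => (R ^ 2 - ‖y - c‖ ^ 2) * (α * l (y - c) + β)) x =
      -(α * (2 * d + 4) * l (x - c) + 2 * d * β) := by
  have hN (y : Rd d) : HasFDerivAt (fun y : Rd d => R ^ 2 - ‖y - c‖ ^ 2)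
      (-(2 • innerSL ℝ (y - c))) y := by
    have h := ((hasFDerivAt_id y).sub_const c).norm_sq.const_sub (R ^ 2)
    simpa using h
  have hl (y : Rd d) : HasFDerivAt (fun y : Rd d => α * l (y - c) + β) (α • l) y := by
    have h := ((l.hasFDerivAt.comp y ((hasFDerivAt_id y).sub_const c)).const_mul α).add_const β
    simpa using h
  have h1 (v y : Rd d) :
      fderiv ℝ (fun y => (R ^ 2 - ‖y - c‖ ^ 2) * (α * l (y - c) + β)) y v =
        (R ^ 2 - ‖y - c‖ ^ 2) * (α * l v) + (α * l (y - c) + β) * (-2 * inner ℝ v (y - c)) := by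
    rw [((hN y).fun_mul (hl y)).fderiv]
    simp [inner_sub_right, real_inner_comm v]
  have hi (v y : Rd d) : HasFDerivAt (fun y : Rd d => -2 * inner ℝ v (y - c))
      ((-2 : ℝ) • innerSL ℝ v) y := by
    have h := (((innerSL ℝ v).hasFDerivAt (x := y - c)).comp y
      ((hasFDerivAt_id y).sub_const c)).const_mul (-2)
    simpa using h
  have h2 (v : Rd d) :
      fderiv ℝ (fun y => fderiv ℝ (fun y => (R ^ 2 - ‖y - c‖ ^ 2) * (α * l (y - c) + β)) y v) x v =
        -4 * α * (inner ℝ v (x - c) * l v) - 2 * (α * l (x - c) + β) * inner ℝ v v := by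
    simp_rw [h1]
    rw [(((hN x).mul_const (α * l v)).fun_add ((hl x).fun_mul (hi v x))).fderiv]
    simp [inner_sub_right, real_inner_comm v]
    ring
  have hsum : ∑ j : Fin d, inner ℝ (𝐞 j) (x - c) * l (𝐞 j) = l (x - c) := by
    conv_rhs => rw [← (EuclideanSpace.basisFun (Fin d) ℝ).sum_repr' (x - c)]
    simp [map_sum]
  unfold lapRd
  simp_rw [h2]
  rw [Finset.sum_sub_distrib, ← Finset.mul_sum, hsum, ← Finset.mul_sum]
  simp
  ring

end Laplacian

/-- `u` is superharmonic on `U` in the sense of distributions. -/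
def WeakSuperharmonicOn {d : ℕ} (u : Rd d → ℝ) (U : Set (Rd d)) : Prop :=
  ∀ χ : Rd d → ℝ, ContDiff ℝ (⊤ : ℕ∞) χ → HasCompactSupport χ → (∀ x, 0 ≤ χ x) →
    tsupport χ ⊆ U → (∫ x : Rd d, u x * lapRd χ x) ≤ 0

/-- Comparison principle: a strictly subharmonic `C²` function lying below a continuous weakly
superharmonic function on a sphere lies below it on the ball. -/
lemma WeakSuperharmonicOn.le_of_le_on_sphere {d : ℕ} {u f : Rd d → ℝ} {U : Set (Rd d)}
    (hsuper : WeakSuperharmonicOn u U) (hu : Continuous u) (hU : IsOpen U) (hf : ContDiff ℝ 2 f)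
    {c : Rd d} {R : ℝ} (hball : Metric.closedBall c R ⊆ U)
    (hlap : ∀ x ∈ Metric.ball c R, 0 < lapRd f x)
    (hsphere : ∀ x ∈ Metric.sphere c R, f x ≤ u x) :
    ∀ x ∈ Metric.closedBall c R, f x ≤ u x := by
  intro x₁ hx₁
  by_contra! hlt
  set ε := (f x₁ - u x₁) / 3 with hε
  have hε0 : 0 < ε := by rw [hε]; linarith
  have hK : IsCompact (Metric.closedBall c R) := isCompact_closedBall c R
  obtain ⟨δ₁, hδ₁, hthick⟩ := hK.exists_cthickening_subset_open hU hball
  obtain ⟨δ₂, hδ₂, hunif⟩ : ∃ δ > 0, ∀ x ∈ Metric.closedBall c R, ∀ y, dist y x < δ →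
      dist (u y) (u x) ≤ ε := by
    have h := hK.uniformContinuousAt_of_continuousAt u (fun a _ => hu.continuousAt)
      (Metric.dist_mem_uniformity hε0)
    obtain ⟨δ, hδ, h⟩ := Metric.mem_uniformity_dist.1 h
    refine ⟨δ, hδ, fun x hx y hy => ?_⟩
    have := h (a := x) (b := y) (by rwa [dist_comm]) hx
    rw [dist_comm]
    exact le_of_lt this
  set r := min δ₁ δ₂ with hr
  have hr0 : 0 < r := lt_min hδ₁ hδ₂
  let b : ContDiffBump (0 : Rd d) := ⟨r / 2, r, by linarith, by linarith⟩
  set ρ : Rd d → ℝ := b.normed volume with hρ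
  have hρs : ContDiff ℝ (⊤ : ℕ∞) ρ := b.contDiff_normed
  have hρ2 : ContDiff ℝ 2 ρ := b.contDiff_normed
  have hρc : HasCompactSupport ρ := b.hasCompactSupport_normed
  set v : Rd d → ℝ := u ⋆[ContinuousLinearMap.lsmul ℝ ℝ] ρ with hv
  have hv2 : ContDiff ℝ 2 v :=
    hρc.contDiff_convolution_right _ hu.locallyIntegrable hρ2
  have hclose : ∀ x ∈ Metric.closedBall c R, |v x - u x| ≤ ε := by
    intro x hx
    have h := b.dist_normed_convolution_le (μ := (volume : Measure (Rd d))) (g := u) (x₀ := x)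
      (ε := ε) hu.aestronglyMeasurable
      (fun y hy => hunif x hx y (lt_of_lt_of_le (Metric.mem_ball.1 hy) (min_le_right _ _)))
    have hflip : v = (ρ ⋆[ContinuousLinearMap.lsmul ℝ ℝ] u) := by
      rw [← convolution_flip]
      rw [hv]
      congr 1
      ext
      simp
    rw [← Real.dist_eq, hflip]
    exact h
  have hvlap : ∀ x ∈ Metric.closedBall c R, lapRd v x ≤ 0 := by
    intro x hx
    rw [hv, lapRd_convolution hu hρ2 hρc]
    simp_rw [← lapRd_comp_const_sub ρ x]
    refine hsuper (fun a => ρ (x - a)) (hρs.comp (contDiff_const.sub contDiff_id))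
      (hρc.comp_homeomorph (Homeomorph.subLeft x)) (fun a => b.nonneg_normed _) ?_
    refine (closure_minimal (t := Metric.closedBall x r) ?_ Metric.isClosed_closedBall).trans ?_
    · intro a ha
      have ha' : x - a ∈ Function.support ρ := ha
      rw [hρ, b.support_normed_eq] at ha'
      rw [Metric.mem_closedBall, dist_comm, dist_eq_norm]
      exact le_of_lt (mem_ball_zero_iff.1 ha')
    · exact (Metric.closedBall_subset_closedBall (min_le_left _ _)).trans
        ((Metric.closedBall_subset_cthickening hx δ₁).trans hthick)
  obtain ⟨z, hz, hzmin⟩ := hK.exists_isMinOn ⟨x₁, hx₁⟩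
    (hv2.continuous.sub hf.continuous).continuousOn
  have hzball : z ∈ Metric.ball c R := by
    rcases (Metric.mem_closedBall.1 hz).lt_or_eq with h | h
    · exact h
    · have h1 := hsphere z h
      have h2 := abs_le.1 (hclose z hz)
      have h3 := abs_le.1 (hclose x₁ hx₁)
      have h4 : v z - f z ≤ v x₁ - f x₁ := hzmin hx₁
      linarith
  have hloc : IsLocalMin (fun y => v y - f y) z :=
    hzmin.isLocalMin (Filter.mem_of_superset (Metric.isOpen_ball.mem_nhds hzball)
      Metric.ball_subset_closedBall)
  have := hloc.lapRd_nonneg (hv2.sub hf)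
  rw [lapRd_sub hv2 hf] at this
  linarith [hvlap z hz, hlap z hzball]

/-- A weakly superharmonic function cannot touch from above an obstacle `φ` at a point where `Δφ`
vanishes to exactly first order. -/
lemma WeakSuperharmonicOn.not_contact {d : ℕ} {u φ : Rd d → ℝ} {U : Set (Rd d)}
    (hsuper : WeakSuperharmonicOn u U) (hu : Continuous u) (hU : IsOpen U) (hφ : ContDiff ℝ 4 φ)
    (hle : ∀ x, φ x ≤ u x) {x₀ : Rd d} (hx₀ : x₀ ∈ U) (hlap : lapRd φ x₀ = 0)
    (hgrad : fderiv ℝ (lapRd φ) x₀ ≠ 0) : u x₀ ≠ φ x₀ := by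
  intro hcontact
  set l := fderiv ℝ (lapRd φ) x₀ with hl
  have hφ2 : ContDiff ℝ 2 φ := hφ.of_le (by norm_num)
  have hdiff : HasFDerivAt (lapRd φ) l x₀ := by
    refine ((contDiff_lapRd (n := 2) ?_).differentiable (by norm_num) x₀).hasFDerivAt
    convert hφ using 1
    norm_num
  obtain ⟨e, he⟩ : ∃ e, 0 < l e := by
    obtain ⟨e, he⟩ := DFunLike.ne_iff.1 hgrad
    rcases lt_or_gt_of_ne he with h | h
    · exact ⟨-e, by simpa using h⟩
    · exact ⟨e, h⟩
  have he0 : 0 < ‖e‖ := norm_pos_iff.2 fun h => by simp [h] at he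
  have hd : 0 < (d : ℝ) := by
    rcases Nat.eq_zero_or_pos d with h | h
    · subst h
      exact absurd (Subsingleton.elim e 0) (norm_pos_iff.1 he0)
    · exact_mod_cast h
  set δ := l e / (4 * (d + 2) * ‖e‖) with hδ
  have hδ0 : 0 < δ := by positivity
  obtain ⟨η, hη, hnear⟩ : ∃ η > 0, ∀ x, dist x x₀ < η →
      x ∈ U ∧ l (x - x₀) - δ * ‖x - x₀‖ ≤ lapRd φ x := by
    refine Metric.eventually_nhds_iff.1 ?_
    filter_upwards [hU.mem_nhds hx₀, hdiff.isLittleO.def hδ0] with x hxU hx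
    rw [hlap, Real.norm_eq_abs] at hx
    exact ⟨hxU, by linarith [(abs_le.1 hx).1]⟩
  set s := η / (4 * ‖e‖) with hs
  have hs0 : 0 < s := by positivity
  have hse : s * ‖e‖ = η / 4 := by rw [hs]; field_simp
  set c := x₀ + s • e with hc
  set R := 2 * (s * ‖e‖) with hR
  have hdist : dist x₀ c = s * ‖e‖ := by
    rw [hc, dist_eq_norm]
    simp [norm_smul, abs_of_pos hs0]
  have hin : ∀ x ∈ Metric.closedBall c R, ‖x - x₀‖ ≤ 3 * (s * ‖e‖) := by
    intro x hx
    rw [← dist_eq_norm]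
    have := dist_triangle x c x₀
    rw [dist_comm c, hdist] at this
    linarith [Metric.mem_closedBall.1 hx]
  have hin' : ∀ x ∈ Metric.closedBall c R, dist x x₀ < η := by
    intro x hx
    rw [dist_eq_norm]
    linarith [hin x hx]
  set α : ℝ := 1 / (2 * d + 4) with hα
  set β : ℝ := s * l e * (2 * d + 2) / (2 * d * (2 * d + 4)) with hβ
  set p : Rd d → ℝ := fun y => (R ^ 2 - ‖y - c‖ ^ 2) * (α * l (y - c) + β) with hp
  have hp2 : ContDiff ℝ 2 p := by
    have h : ContDiff ℝ 2 fun y : Rd d => y - c := contDiff_id.sub contDiff_const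
    exact (contDiff_const.sub (h.norm_sq ℝ)).mul
      ((contDiff_const.mul (l.contDiff.comp h)).add contDiff_const)
  have hcomp := hsuper.le_of_le_on_sphere (f := fun y => φ y - -p y) hu hU (hφ2.sub hp2.neg)
    (c := c) (R := R) (fun x hx => (hnear x (hin' x hx)).1) ?_ ?_ x₀ ?_
  · have hz : x₀ - c = -(s • e) := by rw [hc]; abel
    have hpos : 0 < p x₀ := by
      have h1 : p x₀ = 3 * (s * ‖e‖) ^ 2 * (s * l e / (d * (2 * d + 4))) := by
        simp only [hp, hz, hR, hα, hβ, norm_neg, norm_smul, Real.norm_eq_abs, abs_of_pos hs0,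
          map_neg, map_smul, smul_eq_mul]
        field_simp
        ring
      rw [h1]
      positivity
    linarith
  · intro x hx
    have hx' := Metric.ball_subset_closedBall hx
    rw [lapRd_sub hφ2 hp2.neg, lapRd_neg, hp, lapRd_barrier]
    have h1 := (hnear x (hin' x hx')).2
    have h2 : l (x - x₀) = l (x - c) + s * l e := by
      rw [show x - x₀ = (x - c) + s • e by rw [hc]; abel, map_add, map_smul, smul_eq_mul]
    have h3 : δ * ‖x - x₀‖ ≤ 3 / 4 * (s * l e / (d + 2)) := by
      refine (mul_le_mul_of_nonneg_left (hin x hx') hδ0.le).trans_eq ?_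
      rw [hδ]
      field_simp
    have h4 : α * (2 * d + 4) = 1 := by rw [hα]; field_simp
    have h5 : 2 * d * β = s * l e - s * l e / (d + 2) := by
      rw [hβ]
      field_simp
      ring
    have h6 : 0 < s * l e / (d + 2) := by positivity
    rw [h4, h5]
    linarith
  · intro x hx
    have : p x = 0 := by
      have hx' : ‖x - c‖ = R := by rw [← dist_eq_norm]; exact hx
      simp [hp, hx']
    simpa [this] using hle x
  · rw [Metric.mem_closedBall, hdist, hR]
    nlinarith

/-- **Proposition (the contact sets avoid the degeneracy hypersurfaces
`Γ± = (Δφ±)⁻¹(0)`).** -/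
theorem dop_contact_sets_avoid_degeneracy {d : ℕ}
    (φm φp : Rd d → ℝ) (τ : ℝ) (hτ : 0 < τ)
    (hmreg : ContDiff ℝ 4 φm) (hpreg : ContDiff ℝ 4 φp)
    (hmper : PeriodicRd φm) (hpper : PeriodicRd φp)
    (hmnc : ∃ x y : Rd d, φm x ≠ φm y) (hpnc : ∃ x y : Rd d, φp x ≠ φp y)
    (hsep : ∀ x : Rd d, τ ≤ φp x - φm x)
    (hmaxmin : sInf (Set.range φp) ≤ sSup (Set.range φm))
    (hndm : ∀ x : Rd d, lapRd φm x = 0 → fderiv ℝ (lapRd φm) x ≠ 0)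
    (hndp : ∀ x : Rd d, lapRd φp x = 0 → fderiv ℝ (lapRd φp) x ≠ 0) :
    ∀ u : Rd d → ℝ, IsDOPSolution φm φp u →
      {x | u x = φm x} ∩ {x | lapRd φm x = 0} = ∅ ∧
      {x | u x = φp x} ∩ {x | lapRd φp x = 0} = ∅ := by
  intro u ⟨hu, _, hbd, hsub, hsuper⟩
  rw [Set.eq_empty_iff_forall_notMem, Set.eq_empty_iff_forall_notMem]
  refine ⟨fun x ⟨hx, hlap⟩ => ?_, fun x ⟨hx, hlap⟩ => ?_⟩
  · have hx : u x = φm x := hx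
    refine WeakSuperharmonicOn.not_contact (U := {x | u x < φp x}) hsuper hu
      (isOpen_lt hu hpreg.continuous) hmreg (fun y => (hbd y).1) ?_ hlap (hndm x hlap) hx
    show u x < φp x
    linarith [hsep x]
  · have hx : u x = φp x := hx
    have hlap' : lapRd φp x = 0 := hlap
    have hneg : lapRd (fun y => -φp y) = fun y => -lapRd φp y := funext (lapRd_neg φp)
    refine WeakSuperharmonicOn.not_contact (u := fun y => -u y) (φ := fun y => -φp y)
      (U := {x | φm x < u x}) (fun χ h1 h2 h3 h4 => ?_) hu.neg
      (isOpen_lt hmreg.continuous hu) hpreg.neg (fun y => neg_le_neg (hbd y).2) ?_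
      (by rw [lapRd_neg, hlap', neg_zero]) ?_ (congrArg Neg.neg hx)
    · simp_rw [neg_mul]
      rw [integral_neg]
      linarith [hsub χ h1 h2 h3 h4]
    · show φm x < u x
      linarith [hsep x]
    · rw [hneg, fderiv_fun_neg]
      exact neg_ne_zero.2 (hndp x hlap')
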